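/- The SFA product-form route-level measure is a probability distribution (Theorem 4.2, normalization): under the stability condition Σ_{j ∈ J} B_{lj} α_j < C_l for all l ∈ L, the family n ↦ Φ(n) · ∏_{j ∈ J} α_j^{n_j}, over n : J → ℕ, is summable with Σ_{n : J → ℕ} Φ(n) · ∏_{j ∈ J} α_j^{n_j} = Φ, where Φ = ∏_{l ∈ L} C_l/(C_l − Σ_{j ∈ J} B_{lj} α_j). Consequently π(n) = Φ(n) ∏_j α_j^{n_j} / Φ defines a probability mass function on ℕ^J. -/

import Mathlib

open scoped BigOperators

noncomputable section

/-- The set of resource-route pairs `(l,j)` actually used, i.e. with `B l j > 0`. -/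
abbrev sfaK {L J : Type*} (B : L → J → ℝ) := {p : L × J // 0 < B p.1 p.2}

/-- The weight function of the SFA stationary measure:
`w(m) = ∏_l [ m_l! / ∏_j m_{lj}! ] · ∏_{(l,j) ∈ K} (B_{lj} α_j / C_l)^{m_{lj}}`. -/
noncomputable def sfaW {L J : Type*} [Fintype L] [Fintype J]
    (B : L → J → ℝ) (C : L → ℝ) (α : J → ℝ) (m : sfaK B → ℕ) : ℝ :=
  (∏ l : L,
      ((Nat.factorial (∑ j : {j : J // 0 < B l j}, m ⟨(l, j.1), j.2⟩) : ℝ) /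
        ∏ j : {j : J // 0 < B l j}, (Nat.factorial (m ⟨(l, j.1), j.2⟩) : ℝ))) *
    ∏ p : sfaK B, (B p.1.1 p.1.2 * α p.1.2 / C p.1.1) ^ m p

/-- The normalizing constant `Φ = ∏_l C_l / (C_l - Σ_j B_{lj} α_j)`. -/
noncomputable def sfaPhi {L J : Type*} [Fintype L] [Fintype J]
    (B : L → J → ℝ) (C : L → ℝ) (α : J → ℝ) : ℝ :=
  ∏ l : L, C l / (C l - ∑ j : J, B l j * α j)

/-- The set `U(n)` of multi-configurations `m : K → ℕ` compatible with the route-level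
counts `n : J → ℕ`, i.e. `Σ_{l : (l,j) ∈ K} m(l,j) = n_j` for all `j`. -/
abbrev sfaU {L J : Type*} [Fintype L] (B : L → J → ℝ) (n : J → ℕ) :=
  {m : sfaK B → ℕ // ∀ j : J, (∑ l : {l : L // 0 < B l j}, m ⟨(l.1, j), l.2⟩) = n j}

/-- `Φ(n) = Σ_{m ∈ U(n)} ∏_l [ m_l!/∏_j m_{lj}! ] · ∏_{(l,j) ∈ K} (B_{lj}/C_l)^{m_{lj}}`
(the set `U(n)` is finite, so the `tsum` is just the finite sum). -/
noncomputable def sfaPhiFun {L J : Type*} [Fintype L] [Fintype J]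
    (B : L → J → ℝ) (C : L → ℝ) (n : J → ℕ) : ℝ :=
  ∑' m : sfaU B n,
    (∏ l : L,
        ((Nat.factorial (∑ j : {j : J // 0 < B l j}, m.1 ⟨(l, j.1), j.2⟩) : ℝ) /
          ∏ j : {j : J // 0 < B l j}, (Nat.factorial (m.1 ⟨(l, j.1), j.2⟩) : ℝ))) *
      ∏ p : sfaK B, (B p.1.1 p.1.2 / C p.1.1) ^ m.1 p

/-- Auxiliary predicate: sums of products over a finite dependent product factor. -/
def SfaAuxPi.{u, v} (ι : Type u) : Prop :=
  ∀ [Fintype ι] (β : ι → Type v)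
      (f : ∀ i, β i → ℝ) (a : ι → ℝ), (∀ i x, 0 ≤ f i x) → (∀ i, HasSum (f i) (a i)) →
      HasSum (fun x : ∀ i, β i => ∏ i, f i (x i)) (∏ i, a i)

theorem sfaAux_of_equiv.{u, v} {ι κ : Type u} (e : ι ≃ κ) (ih : SfaAuxPi.{u, v} ι) :
    SfaAuxPi.{u, v} κ := by
  intro _ β f a hf h
  letI := Fintype.ofEquiv κ e.symm
  have := ih (fun i => β (e i)) (fun i => f (e i)) (fun i => a (e i))
    (fun i => hf _) (fun i => h _)
  rw [← (Equiv.piCongrLeft β e).hasSum_iff, ← e.prod_comp a]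
  refine Eq.subst (motive := fun g => HasSum g _) (funext fun x => ?_) this
  rw [Function.comp_apply, ← e.prod_comp]
  refine Finset.prod_congr rfl fun i _ => ?_
  rw [Equiv.piCongrLeft_apply_apply]

theorem sfaAux_option.{u, v} {ι : Type u} [Fintype ι] (ih : SfaAuxPi.{u, v} ι) :
    SfaAuxPi.{u, v} (Option ι) := by
  intro hfin β f a hf h
  obtain rfl : hfin = instFintypeOption := Subsingleton.elim _ _
  have h1 := ih (fun i => β (some i)) (fun i => f (some i)) (fun i => a (some i))
    (fun i => hf _) (fun i => h _)
  have h2 := (h none).mul h1 ((h none).summable.mul_of_nonneg h1.summable (hf none)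
    (fun x => Finset.prod_nonneg fun i _ => hf _ _))
  rw [← (Equiv.piOptionEquivProd (β := β)).hasSum_iff] at h2
  rw [Fintype.prod_option]
  refine Eq.subst (motive := fun g => HasSum g _) (funext fun x => ?_) h2
  rw [Fintype.prod_option]
  rfl

theorem sfaAux_hasSum_pi.{u, v} {ι : Type u} [Fintype ι] :
    ∀ (β : ι → Type v) (f : ∀ i, β i → ℝ) (a : ι → ℝ), (∀ i x, 0 ≤ f i x) →
      (∀ i, HasSum (f i) (a i)) →
      HasSum (fun x : ∀ i, β i => ∏ i, f i (x i)) (∏ i, a i) := by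
  have main : ∀ (ι : Type u) [Finite ι], SfaAuxPi.{u, v} ι := by
    intro ι _
    induction ι using Finite.induction_empty_option with
    | of_equiv e ih => exact sfaAux_of_equiv e ih
    | h_empty =>
      intro _ β f a hf h
      simpa using hasSum_unique (fun x : (∀ i, β i) => (1 : ℝ))
    | h_option ih => exact sfaAux_option ih
  exact main ι

theorem sfaAux_multinomial {ι : Type*} [Fintype ι] (x : ι → ℝ) (hx : ∀ i, 0 ≤ x i)
    (h1 : ∑ i, x i < 1) :
    HasSum (fun k : ι → ℕ => ((Nat.factorial (∑ i, k i) : ℝ) /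
      ∏ i, (Nat.factorial (k i) : ℝ)) * ∏ i, x i ^ k i) (1 - ∑ i, x i)⁻¹ := by
  classical
  have hg := hasSum_geometric_of_lt_one (Finset.sum_nonneg fun i _ => hx i) h1
  let p : (ι → ℕ) → ℕ := fun k => ∑ i, k i
  rw [← (Equiv.sigmaFiberEquiv p).hasSum_iff]
  have hfib : ∀ n, HasSum (fun c : {k // p k = n} => (((Nat.factorial (∑ i, c.1 i) : ℝ) /
      ∏ i, (Nat.factorial (c.1 i) : ℝ)) * ∏ i, x i ^ c.1 i)) ((∑ i, x i) ^ n) := by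
    intro n
    rw [Finset.sum_pow_eq_sum_piAntidiag]
    have hs : ∀ k : ι → ℕ, k ∈ Finset.piAntidiag Finset.univ n ↔ p k = n := by
      intro k; simp [p]
    rw [← (Equiv.subtypeEquivRight hs).hasSum_iff]
    rw [← Finset.sum_coe_sort]
    have h0 := hasSum_fintype (fun c :
      {k // k ∈ Finset.piAntidiag Finset.univ n} =>
        (Nat.multinomial Finset.univ c.1 : ℝ) * ∏ i, x i ^ c.1 i)
    refine Eq.subst (motive := fun g => HasSum g _) (funext fun c => Eq.symm ?_) h0
    simp only [Function.comp_apply, Equiv.subtypeEquivRight_apply_coe]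
    congr 1
    rw [div_eq_iff (Finset.prod_ne_zero_iff.2 fun i _ => by positivity), mul_comm]
    exact_mod_cast (Nat.multinomial_spec Finset.univ c.1).symm
  refine HasSum.sigma_of_hasSum hg hfib ?_
  rw [summable_sigma_of_nonneg]
  · refine ⟨fun n => (hfib n).summable, ?_⟩
    have : (fun n => ∑' c : {k // p k = n}, (((Nat.factorial (∑ i, c.1 i) : ℝ) /
      ∏ i, (Nat.factorial (c.1 i) : ℝ)) * ∏ i, x i ^ c.1 i)) = fun n => (∑ i, x i) ^ n := by
      ext n; exact (hfib n).tsum_eq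
    exact this ▸ hg.summable
  · rintro ⟨n, k, hk⟩
    exact mul_nonneg (by positivity) (Finset.prod_nonneg fun i _ => pow_nonneg (hx i) _)

/-- Split a configuration by resource. -/
def sfaAuxEquiv {L J : Type*} (B : L → J → ℝ) :
    (sfaK B → ℕ) ≃ (∀ l : L, {j : J // 0 < B l j} → ℕ) where
  toFun m l j := m ⟨(l, j.1), j.2⟩
  invFun k p := k p.1.1 ⟨p.1.2, p.2⟩
  left_inv _ := rfl
  right_inv _ := rfl

/-- Pairs in `K` as a sigma type. -/
def sfaAuxSigma {L J : Type*} (B : L → J → ℝ) :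
    (Σ l : L, {j : J // 0 < B l j}) ≃ sfaK B where
  toFun q := ⟨(q.1, q.2.1), q.2.2⟩
  invFun p := ⟨p.1.1, p.1.2, p.2⟩
  left_inv _ := rfl
  right_inv _ := rfl

/-- Pairs in `K` as a sigma type, by route. -/
def sfaAuxSigma2 {L J : Type*} (B : L → J → ℝ) :
    (Σ j : J, {l : L // 0 < B l j}) ≃ sfaK B where
  toFun q := ⟨(q.2.1, q.1), q.2.2⟩
  invFun p := ⟨p.1.2, p.1.1, p.2⟩
  left_inv _ := rfl
  right_inv _ := rfl

theorem sfaAux_subsum {J : Type*} [Fintype J] (b α : J → ℝ) (hb : ∀ j, 0 ≤ b j) :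
    ∑ j : {j : J // 0 < b j}, b j.1 * α j.1 = ∑ j, b j * α j := by
  classical
  rw [← Finset.sum_subtype (s := Finset.univ.filter fun j => 0 < b j)
    (p := fun j => 0 < b j) (by simp) (fun j => b j * α j)]
  refine Finset.sum_subset (Finset.subset_univ _) fun j _ hj => ?_
  have : b j = 0 := le_antisymm (by simpa using hj) (hb j)
  simp [this]

theorem sfaAux_W {L J : Type*} [Fintype L] [Fintype J]
    (B : L → J → ℝ) (C : L → ℝ) (α : J → ℝ)
    (hB : ∀ l j, 0 ≤ B l j) (hC : ∀ l, 0 < C l) (hα : ∀ j, 0 ≤ α j)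
    (hstab : ∀ l, (∑ j : J, B l j * α j) < C l) :
    HasSum (sfaW B C α) (sfaPhi B C α) := by
  have hs : ∀ l, ∑ j : {j : J // 0 < B l j}, B l j.1 * α j.1 / C l
      = (∑ j, B l j * α j) / C l := by
    intro l
    rw [← Finset.sum_div, sfaAux_subsum _ _ (hB l)]
  have key := sfaAux_hasSum_pi (fun l : L => {j : J // 0 < B l j} → ℕ) _ _ ?_
    (fun l => sfaAux_multinomial (fun j : {j : J // 0 < B l j} => B l j.1 * α j.1 / C l)
      (fun j => div_nonneg (mul_nonneg (hB _ _) (hα _)) (hC l).le)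
      (by rw [hs, div_lt_one (hC l)]; exact hstab l))
  · rw [← (sfaAuxEquiv B).hasSum_iff] at key
    convert! key using 1
    · ext m
      rw [Function.comp_apply, Finset.prod_mul_distrib, sfaW, ← (sfaAuxSigma B).prod_comp,
        Fintype.prod_sigma]
      rfl
    · refine Finset.prod_congr rfl fun l _ => ?_
      rw [hs]
      have h1 := (hC l).ne'
      have h2 := (sub_pos.2 (hstab l)).ne'
      rw [one_sub_div h1, inv_div]
  · intro l k
    exact mul_nonneg (by positivity) (Finset.prod_nonneg fun i _ => pow_nonneg
      (div_nonneg (mul_nonneg (hB _ _) (hα _)) (hC l).le) _)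

theorem sfaAux_Phi {L J : Type*} [Fintype L] [Fintype J]
    (B : L → J → ℝ) (C : L → ℝ) (α : J → ℝ)
    (hW : HasSum (sfaW B C α) (sfaPhi B C α)) :
    HasSum (fun n : J → ℕ => sfaPhiFun B C n * ∏ j : J, α j ^ n j) (sfaPhi B C α) := by
  let p : (sfaK B → ℕ) → J → ℕ := fun m j => ∑ l : {l : L // 0 < B l j}, m ⟨(l.1, j), l.2⟩
  let e : (Σ n : J → ℕ, sfaU B n) ≃ (sfaK B → ℕ) :=
    { toFun := fun q => q.2.1
      invFun := fun m => ⟨p m, m, fun _ => rfl⟩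
      left_inv := by
        rintro ⟨n, m, h⟩
        obtain rfl : p m = n := funext h
        rfl
      right_inv := fun _ => rfl }
  rw [← e.hasSum_iff] at hW
  refine hW.sigma fun n => ?_
  have hsum := hW.summable.sigma_factor n
  convert! hsum.hasSum using 1
  rw [sfaPhiFun, ← tsum_mul_right]
  refine tsum_congr fun m => ?_
  change _ = sfaW B C α m.1
  rw [sfaW, mul_assoc]
  congr 1
  have : ∏ j, α j ^ n j = ∏ q : sfaK B, α q.1.2 ^ m.1 q := by
    rw [← (sfaAuxSigma2 B).prod_comp, Fintype.prod_sigma]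
    refine Finset.prod_congr rfl fun j _ => ?_
    rw [← m.2 j, ← Finset.prod_pow_eq_pow_sum]
    rfl
  rw [this, ← Finset.prod_mul_distrib]
  refine Finset.prod_congr rfl fun q _ => ?_
  rw [← mul_pow]
  ring

/-- normalization of the SFA product-form route-level measure. Under the
stability condition `Σ_j B_{lj} α_j < C_l` for all `l`, the family
`n ↦ Φ(n) ∏_j α_j^{n_j}` is summable with sum `Φ`, so `π(n) = Φ(n) ∏_j α_j^{n_j} / Φ`
is a probability mass function on `ℕ^J`. -/
theorem sfa_route_level_normalization
    {L J : Type*} [Fintype L] [Fintype J] [Nonempty L] [Nonempty J]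
    (B : L → J → ℝ) (C : L → ℝ) (α : J → ℝ)
    (hB : ∀ l j, 0 ≤ B l j) (hC : ∀ l, 0 < C l) (hα : ∀ j, 0 ≤ α j)
    (hstab : ∀ l, (∑ j : J, B l j * α j) < C l) :
    Summable (fun n : J → ℕ => sfaPhiFun B C n * ∏ j : J, α j ^ n j) ∧
      (∑' n : J → ℕ, sfaPhiFun B C n * ∏ j : J, α j ^ n j) = sfaPhi B C α ∧
      (∀ n : J → ℕ, 0 ≤ sfaPhiFun B C n * (∏ j : J, α j ^ n j) / sfaPhi B C α) ∧
      (∑' n : J → ℕ, sfaPhiFun B C n * (∏ j : J, α j ^ n j) / sfaPhi B C α) = 1 := by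
  have h := sfaAux_Phi B C α (sfaAux_W B C α hB hC hα hstab)
  have hpos : 0 < sfaPhi B C α :=
    Finset.prod_pos fun l _ => div_pos (hC l) (sub_pos.2 (hstab l))
  refine ⟨h.summable, h.tsum_eq, fun n => ?_, ?_⟩
  · refine div_nonneg (mul_nonneg ?_ (Finset.prod_nonneg fun j _ => pow_nonneg (hα j) _)) hpos.le
    refine tsum_nonneg fun m => mul_nonneg (by positivity) (Finset.prod_nonneg fun q _ =>
      pow_nonneg (div_nonneg (hB _ _) (hC _).le) _)
  · rw [(h.div_const _).tsum_eq, div_self hpos.ne']
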